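/- arXiv:math-ph/0011013 — 5 statements merged into one kernel-verified Lean document; each statement's English description precedes it below -/
import Mathlib

section
/- Let H be a complex Hilbert space, let H₀ and V be bounded self-adjoint operators on H with ‖V‖ ≤ V₀, and let E ∈ ℝ, g > 0, δ ≥ 0. Let Q₀ be an orthogonal projection commuting with H₀ such that Q₀(H₀ − E)Q₀ ≥ g·Q₀ in the sense of quadratic forms, and let P be an orthogonal projection with ‖P(H₀ + V − E)‖ ≤ δ. Then ‖P Q₀ P‖ ≤ (δ + V₀)/g. -/
/-- If `Q` is an orthogonal projection commuting with `A` and `Q A Q ≥ g Q`, then `A` is bounded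
below by `g` on the range of `Q`. -/
lemma mul_norm_apply_le_of_isPositive_sub
    {H : Type*} [NormedAddCommGroup H] [InnerProductSpace ℂ H] [CompleteSpace H]
    {A Q : H →L[ℂ] H} {g : ℝ} (hQ : Q * Q = Q) (hQsa : IsSelfAdjoint Q)
    (hcomm : A * Q = Q * A) (hgap : (Q * A * Q - (g : ℂ) • Q).IsPositive) (x : H) :
    g * ‖Q x‖ ≤ ‖A x‖ := by
  have hsymm (y z : H) : inner ℂ (Q y) z = inner ℂ y (Q z) := hQsa.isSymmetric y z
  have hQQ : Q (Q x) = Q x := DFunLike.congr_fun hQ x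
  have hQAQ : Q * A * Q = Q * A := by rw [mul_assoc, hcomm, ← mul_assoc, hQ]
  have hpos := hgap.re_inner_nonneg_left x
  have hinner : inner ℂ ((Q * A * Q - (g : ℂ) • Q) x) x
      = inner ℂ (A x) (Q x) - (g : ℂ) * inner ℂ (Q x) (Q x) := by
    rw [hQAQ, ← hsymm (Q x) x, hQQ]
    simp [hsymm (A x)]
  rw [hinner, inner_self_eq_norm_sq_to_K] at hpos
  have hre : g * ‖Q x‖ ^ 2 ≤ (inner ℂ (A x) (Q x) : ℂ).re := by
    simpa [← Complex.ofReal_pow] using hpos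
  have hsq : g * ‖Q x‖ ^ 2 ≤ ‖A x‖ * ‖Q x‖ :=
    hre.trans ((Complex.re_le_norm _).trans (norm_inner_le_norm _ _))
  rcases (norm_nonneg (Q x)).eq_or_lt with h0 | h0
  · simp [← h0]
  · exact le_of_mul_le_mul_right (by linarith) h0

/-- Abstract version of the bound `‖P Q₀ P‖ ≤ (δ + V₀)/g`: `Q₀` is an
orthogonal projection commuting with `H₀` whose energy above `E` is at least `g`, `V` is a
bounded self-adjoint perturbation with `‖V‖ ≤ V₀`, and `P` is an orthogonal projection with
`‖P(H₀ + V - E)‖ ≤ δ`. -/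
theorem norm_PQ₀P_le
    {H : Type*} [NormedAddCommGroup H] [InnerProductSpace ℂ H] [CompleteSpace H]
    (H₀ V : H →L[ℂ] H) (hH₀ : IsSelfAdjoint H₀) (hV : IsSelfAdjoint V)
    (V₀ E g δ : ℝ) (hV₀ : ‖V‖ ≤ V₀) (hg : 0 < g) (hδ : 0 ≤ δ)
    (Q₀ : H →L[ℂ] H) (hQ₀ : Q₀ * Q₀ = Q₀) (hQ₀sa : IsSelfAdjoint Q₀)
    (hcomm : H₀ * Q₀ = Q₀ * H₀)
    (hgap : (Q₀ * (H₀ - (E : ℂ) • 1) * Q₀ - (g : ℂ) • Q₀).IsPositive)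
    (P : H →L[ℂ] H) (hP : P * P = P) (hPsa : IsSelfAdjoint P)
    (hPd : ‖P * ((H₀ + V) - (E : ℂ) • 1)‖ ≤ δ) :
    ‖P * Q₀ * P‖ ≤ (δ + V₀) / g := by
  set A : H →L[ℂ] H := H₀ - (E : ℂ) • 1 with hA
  have hAsa : IsSelfAdjoint A := by
    refine hH₀.sub (IsSelfAdjoint.smul ?_ (.one _))
    exact Complex.conj_ofReal E
  have hAQ : A * Q₀ = Q₀ * A := by simp [hA, sub_mul, mul_sub, hcomm]
  have hPnorm : ‖P‖ ≤ 1 := IsStarProjection.norm_le P ⟨hP, hPsa⟩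
  have hAP : ‖A * P‖ ≤ δ + V₀ := by
    have hPA : P * A = P * ((H₀ + V) - (E : ℂ) • 1) - P * V := by
      rw [← mul_sub, hA]
      congr 1
      abel
    calc ‖A * P‖ = ‖P * A‖ := by
          rw [← norm_star, star_mul, hAsa.star_eq, hPsa.star_eq]
      _ ≤ ‖P * ((H₀ + V) - (E : ℂ) • 1)‖ + ‖P * V‖ := hPA ▸ norm_sub_le _ _
      _ ≤ δ + V₀ := by
          refine add_le_add hPd ((norm_mul_le P V).trans ?_)
          exact (mul_le_of_le_one_left (norm_nonneg V) hPnorm).trans hV₀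
  have hnonneg : 0 ≤ (δ + V₀) / g := div_nonneg ((norm_nonneg _).trans hAP) hg.le
  have hQP : ‖Q₀ * P‖ ≤ (δ + V₀) / g := by
    refine ContinuousLinearMap.opNorm_le_bound _ hnonneg fun x => ?_
    rw [div_mul_eq_mul_div, le_div_iff₀' hg]
    exact (mul_norm_apply_le_of_isPositive_sub hQ₀ hQ₀sa hAQ hgap (P x)).trans
      ((A * P).le_of_opNorm_le hAP x)
  rw [mul_assoc]
  exact (norm_mul_le _ _).trans ((mul_le_of_le_one_left (norm_nonneg _) hPnorm).trans hQP)
end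

section
/- Let H be a complex separable Hilbert space, let H₀ and V be bounded self-adjoint operators on H, set Ham = H₀ + V, and let c ∈ ℝ and ε > 0. Let P₀ be an orthogonal projection with H₀P₀ = c·P₀ = P₀H₀, and let P be a finite-rank orthogonal projection commuting with Ham such that (P(Ham − c)P)² ≥ ε²·P in the sense of quadratic forms. Then Tr(P₀ P P₀) ≤ ε⁻² · Tr(P₀ V P V P₀). -/
open scoped InnerProductSpace

/-- A fixed Hilbert basis index set for `H`. -/
noncomputable def hilbertSet (H : Type*) [NormedAddCommGroup H] [InnerProductSpace ℂ H]
    [CompleteSpace H] : Set H :=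
  (exists_hilbertBasis ℂ H).choose

/-- A fixed Hilbert basis of `H`. -/
noncomputable def stdHilbertBasis (H : Type*) [NormedAddCommGroup H] [InnerProductSpace ℂ H]
    [CompleteSpace H] : HilbertBasis (hilbertSet H) ℂ H :=
  (exists_hilbertBasis ℂ H).choose_spec.choose

variable {H : Type*} [NormedAddCommGroup H] [InnerProductSpace ℂ H] [CompleteSpace H]

/-- The trace of an operator, computed in the fixed Hilbert basis.  (For trace-class
operators this value is independent of the choice of basis.) -/
noncomputable def opTrace (T : H →L[ℂ] H) : ℂ :=
  ∑' i : hilbertSet H, ⟪stdHilbertBasis H i, T (stdHilbertBasis H i)⟫_ℂ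

/-- The absolute value `|T| = √(T⋆T)` of a bounded operator. -/
noncomputable def absOp (T : H →L[ℂ] H) : H →L[ℂ] H :=
  CFC.sqrt (ContinuousLinearMap.adjoint T * T)

/-- The trace norm `‖T‖₁ = Tr |T|` of a bounded operator. -/
noncomputable def traceNorm (T : H →L[ℂ] H) : ℝ :=
  (opTrace (absOp T)).re

/-- `T` is trace class iff `Tr |T|`, computed in the fixed Hilbert basis, converges. -/
def IsTraceClass (T : H →L[ℂ] H) : Prop :=
  Summable fun i : hilbertSet H =>
    (⟪stdHilbertBasis H i, absOp T (stdHilbertBasis H i)⟫_ℂ).re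

/-- A bounded operator of finite rank is Hilbert-Schmidt. -/
theorem Orthonormal.summable_norm_sq_apply_of_finiteDimensional_range {ι : Type*} {b : ι → H}
    (hb : Orthonormal ℂ b) (T : H →L[ℂ] H)
    [FiniteDimensional ℂ (LinearMap.range T.toLinearMap)] :
    Summable fun i => ‖T (b i)‖ ^ 2 := by
  let u := stdOrthonormalBasis ℂ (LinearMap.range T.toLinearMap)
  have key : ∀ i, ‖T (b i)‖ ^ 2 =
      ∑ j, ‖⟪b i, ContinuousLinearMap.adjoint T (u j : H)⟫_ℂ‖ ^ 2 := by
    intro i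
    let y : LinearMap.range T.toLinearMap := ⟨T (b i), LinearMap.mem_range_self _ (b i)⟩
    have h := u.sum_sq_norm_inner_left y
    simp only [Submodule.coe_inner, Submodule.coe_norm, y] at h
    rw [← h]
    simp only [ContinuousLinearMap.adjoint_inner_right]
  simp only [key]
  exact summable_sum fun j _ => hb.inner_products_summable _

/-- Sandwiching an orthogonal projection as `A⋆PA` gives the quadratic form `‖PAx‖²`. -/
theorem inner_sandwich_projection_eq_norm_sq {A B P : H →L[ℂ] H}
    (hAB : ContinuousLinearMap.adjoint A = B) (hP : P * P = P) (hPsa : IsSelfAdjoint P) (x : H) :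
    ⟪x, (B * P * A) x⟫_ℂ = ((‖(P * A) x‖ ^ 2 : ℝ) : ℂ) := by
  subst hAB
  have hPP : P (A x) = P (P (A x)) := (DFunLike.congr_fun hP (A x)).symm
  have hadj : ContinuousLinearMap.adjoint P = P := hPsa
  rw [mul_apply_eq_comp, mul_apply_eq_comp,
    ContinuousLinearMap.adjoint_inner_right, hPP, ← ContinuousLinearMap.adjoint_inner_left, hadj,
    inner_self_eq_norm_sq_to_K]
  simp

/-- The trace of `A⋆PA`, with `P` a finite-rank orthogonal projection, is a convergent sum of
squares. -/
theorem hasSum_re_opTrace_sandwich {A B P : H →L[ℂ] H}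
    (hAB : ContinuousLinearMap.adjoint A = B) (hP : P * P = P) (hPsa : IsSelfAdjoint P)
    (hfin : FiniteDimensional ℂ (LinearMap.range P.toLinearMap)) :
    HasSum (fun i => ‖(P * A) (stdHilbertBasis H i)‖ ^ 2) (opTrace (B * P * A)).re := by
  have : FiniteDimensional ℂ (LinearMap.range (P * A).toLinearMap) :=
    Submodule.finiteDimensional_of_le
      (LinearMap.range_comp_le_range A.toLinearMap P.toLinearMap)
  have hs := (stdHilbertBasis H).orthonormal.summable_norm_sq_apply_of_finiteDimensional_range
    (P * A)
  simp only [opTrace, inner_sandwich_projection_eq_norm_sq hAB hP hPsa]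
  rw [← Complex.ofReal_tsum, Complex.ofReal_re]
  exact hs.hasSum

/-- Abstract form of the eigenvalue-counting step: if `H₀P₀ = cP₀ = P₀H₀`
and `P` is a finite-rank orthogonal projection commuting with `Ham = H₀ + V` such that
`(P(Ham - c)P)² ≥ ε²P`, then `Tr(P₀ P P₀) ≤ ε⁻² Tr(P₀ V P V P₀)`. -/
theorem trace_landau_le_potential [TopologicalSpace.SeparableSpace H]
    (H₀ V : H →L[ℂ] H) (hH₀ : IsSelfAdjoint H₀) (hV : IsSelfAdjoint V)
    (c : ℝ) (ε : ℝ) (hε : 0 < ε)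
    (P₀ : H →L[ℂ] H) (hP₀ : P₀ * P₀ = P₀) (hP₀sa : IsSelfAdjoint P₀)
    (hc₁ : H₀ * P₀ = (c : ℂ) • P₀) (hc₂ : P₀ * H₀ = (c : ℂ) • P₀)
    (P : H →L[ℂ] H) (hP : P * P = P) (hPsa : IsSelfAdjoint P)
    (hfin : FiniteDimensional ℂ (LinearMap.range P.toLinearMap))
    (hcomm : (H₀ + V) * P = P * (H₀ + V))
    (hgap : ((P * ((H₀ + V) - (c : ℂ) • 1) * P) ^ 2 - ((ε : ℂ) ^ 2) • P).IsPositive) :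
    (opTrace (P₀ * P * P₀)).re ≤ ε⁻¹ ^ 2 * (opTrace (P₀ * V * P * V * P₀)).re := by
  have adj₀ : ContinuousLinearMap.adjoint P₀ = P₀ := hP₀sa
  have adjV : ContinuousLinearMap.adjoint (V * P₀) = P₀ * V := by
    simp only [← ContinuousLinearMap.star_eq_adjoint, star_mul, hP₀sa.star_eq, hV.star_eq]
  have hL := hasSum_re_opTrace_sandwich adj₀ hP hPsa hfin
  have hR := hasSum_re_opTrace_sandwich adjV hP hPsa hfin
  set K : H →L[ℂ] H := (H₀ + V) - (c : ℂ) • 1 with hK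
  have hKP : K * P = P * K := by
    rw [hK, sub_mul, mul_sub, hcomm]; simp
  have hK₀ : K * P₀ = V * P₀ := by
    rw [hK, sub_mul, add_mul, hc₁]; simp
  have h₀K : P₀ * K = P₀ * V := by
    rw [hK, mul_sub, mul_add, hc₂]; simp
  have hsq : (P * K * P) ^ 2 = K * P * K := by
    have h : P * K * P = P * K := by rw [mul_assoc, hKP, ← mul_assoc, hP]
    rw [h, sq, ← mul_assoc, h, ← hKP]
  have hid : P₀ * ((P * K * P) ^ 2 - ((ε : ℂ) ^ 2) • P) * P₀ =
      P₀ * V * P * (V * P₀) - ((ε : ℂ) ^ 2) • (P₀ * P * P₀) := by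
    rw [hsq, mul_sub, sub_mul, mul_smul_comm, smul_mul_assoc, ← hK₀, ← h₀K]
    simp only [mul_assoc]
  have hle : ∀ x, ε ^ 2 * ‖(P * P₀) x‖ ^ 2 ≤ ‖(P * (V * P₀)) x‖ ^ 2 := by
    intro x
    have h := (hgap.conj_adjoint P₀).re_inner_nonneg_right x
    rw [adj₀] at h
    change 0 ≤ RCLike.re ⟪x, (P₀ * ((P * K * P) ^ 2 - ((ε : ℂ) ^ 2) • P) * P₀) x⟫_ℂ at h
    rw [hid, sub_apply, smul_apply, inner_sub_right,
      inner_smul_right, inner_sandwich_projection_eq_norm_sq adjV hP hPsa,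
      inner_sandwich_projection_eq_norm_sq adj₀ hP hPsa, ← Complex.ofReal_pow,
      ← Complex.ofReal_mul, ← Complex.ofReal_sub] at h
    exact sub_nonneg.mp h
  have hfinal := hasSum_le (fun i => hle (stdHilbertBasis H i)) (hL.mul_left (ε ^ 2)) hR
  rw [← mul_assoc] at hfinal
  rwa [inv_pow, ← div_eq_inv_mul, le_div_iff₀' (by positivity)]
end

section
/- Let H be a complex separable Hilbert space, let H₀ and V be bounded self-adjoint operators on H with ‖V‖ ≤ V₀, set Ham = H₀ + V, and let c, E ∈ ℝ, ε > 0, g > 0, δ ≥ 0 with (δ + V₀)/g ≤ 1/2. Let P₀ be an orthogonal projection with H₀P₀ = c·P₀ = P₀H₀, suppose Q₀ := 1 − P₀ satisfies Q₀(H₀ − E)Q₀ ≥ g·Q₀, and let P be a finite-rank orthogonal projection commuting with Ham such that ‖P(Ham − E)‖ ≤ δ and (P(Ham − c)P)² ≥ ε²·P. Then Tr P ≤ 2ε⁻² · Tr(P₀ V P V P₀). -/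
open scoped InnerProductSpace

variable {H : Type*} [NormedAddCommGroup H] [InnerProductSpace ℂ H] [CompleteSpace H]

open ContinuousLinearMap in
/-- If `S` takes values in a finite-dimensional subspace `K`, then the trace of `S† S` can be
computed from `S†` on an orthonormal basis of `K`. -/
theorem opTrace_adjoint_mul_self {ι : Type*} [Fintype ι] (K : Submodule ℂ H)
    (u : OrthonormalBasis ι ℂ K) (S : H →L[ℂ] H) (hS : ∀ x, S x ∈ K) :
    (opTrace (adjoint S * S)).re = ∑ j, ‖adjoint S (u j : H)‖ ^ 2 := by
  have h : HasSum (fun i => ⟪stdHilbertBasis H i, (adjoint S * S) (stdHilbertBasis H i)⟫_ℂ)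
      (∑ j, ⟪adjoint S (u j : H), adjoint S (u j : H)⟫_ℂ) := by
    have h₁ := hasSum_sum (s := Finset.univ) fun j _ =>
      (stdHilbertBasis H).hasSum_inner_mul_inner (adjoint S (u j : H)) (adjoint S (u j : H))
    refine h₁.congr_fun fun i => ?_
    have h₂ := u.sum_inner_mul_inner ⟨_, hS (stdHilbertBasis H i)⟩ ⟨_, hS (stdHilbertBasis H i)⟩
    simp only [Submodule.coe_inner] at h₂
    rw [mul_apply_eq_comp, adjoint_inner_right, ← h₂]
    refine Finset.sum_congr rfl fun j _ => ?_
    rw [adjoint_inner_left, adjoint_inner_right, mul_comm]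
  rw [opTrace, h.tsum_eq, Complex.re_sum]
  refine Finset.sum_congr rfl fun j _ => ?_
  exact inner_self_eq_norm_sq (𝕜 := ℂ) _

/-- Pythagoras for an orthogonal projection. -/
theorem norm_sq_eq_of_isSelfAdjoint_idem (P₀ : H →L[ℂ] H) (hP₀ : P₀ * P₀ = P₀)
    (hP₀sa : IsSelfAdjoint P₀) (x : H) : ‖x‖ ^ 2 = ‖P₀ x‖ ^ 2 + ‖x - P₀ x‖ ^ 2 := by
  have h : ⟪P₀ x, x - P₀ x⟫_ℂ = 0 := by
    have h₁ : P₀ (P₀ x) = P₀ x := congr($hP₀ x)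
    have h₂ : P₀ (x - P₀ x) = 0 := by rw [map_sub, h₁, sub_self]
    exact (hP₀sa.isSymmetric x _).trans (by simp [h₂])
  have := norm_add_sq_eq_norm_sq_add_norm_sq_of_inner_eq_zero _ _ h
  rw [add_sub_cancel] at this
  nlinarith

/-- An approximate eigenvector of `H₀ + V` near `E` is mostly contained in the range of `P₀`. -/
theorem norm_sub_apply_le_of_isPositive
    (H₀ V : H →L[ℂ] H) (V₀ : ℝ) (hV₀ : ‖V‖ ≤ V₀) (c E g δ : ℝ) (hg : 0 < g)
    (P₀ : H →L[ℂ] H) (hP₀ : P₀ * P₀ = P₀) (hP₀sa : IsSelfAdjoint P₀)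
    (hc₁ : H₀ * P₀ = (c : ℂ) • P₀) (hc₂ : P₀ * H₀ = (c : ℂ) • P₀)
    (hQ₀ : ((1 - P₀) * (H₀ - (E : ℂ) • 1) * (1 - P₀) - (g : ℂ) • (1 - P₀)).IsPositive)
    (x : H) (hx : ‖((H₀ + V) - (E : ℂ) • 1) x‖ ≤ δ * ‖x‖) :
    ‖x - P₀ x‖ ≤ (δ + V₀) / g * ‖x‖ := by
  have hidem : (1 - P₀) * (1 - P₀) = 1 - P₀ := by
    simp [mul_sub, sub_mul, hP₀]
  have hsa : IsSelfAdjoint (1 - P₀) := (IsSelfAdjoint.one _).sub hP₀sa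
  set y := x - P₀ x with hy
  have hyQ : (1 - P₀) x = y := by simp [hy]
  have hcompr : (1 - P₀) * (H₀ - (E : ℂ) • 1) * (1 - P₀)
      = (1 - P₀) * (((H₀ + V) - (E : ℂ) • 1) - V) := by
    simp [mul_sub, sub_mul, mul_add, hc₁, hc₂, hP₀]
    abel
  have h₀ := hQ₀.re_inner_nonneg_right x
  rw [hcompr] at h₀
  have h₁ : RCLike.re ⟪x, ((1 - P₀) * (((H₀ + V) - (E : ℂ) • 1) - V)) x⟫_ℂ
      = RCLike.re ⟪y, (((H₀ + V) - (E : ℂ) • 1) x - V x)⟫_ℂ := by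
    rw [← hyQ]
    exact congrArg _ (hsa.isSymmetric x _).symm
  have h₂ : RCLike.re ⟪x, ((g : ℂ) • (1 - P₀)) x⟫_ℂ = g * ‖y‖ ^ 2 := by
    have h₃ : ⟪x, y⟫_ℂ = ⟪y, y⟫_ℂ := by
      have h₄ : (1 - P₀) y = y := by rw [← hyQ]; exact congr($hidem x)
      have h₅ : ⟪(1 - P₀) x, y⟫_ℂ = ⟪x, (1 - P₀) y⟫_ℂ := hsa.isSymmetric x y
      rw [← h₄, ← h₅, hyQ, h₄]
    rw [smul_apply, hyQ, inner_smul_right, h₃, ← inner_self_eq_norm_sq (𝕜 := ℂ) y]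
    exact Complex.re_ofReal_mul _ _
  have h₃ : g * ‖y‖ ^ 2 ≤ ‖y‖ * ((δ + V₀) * ‖x‖) := by
    calc g * ‖y‖ ^ 2 ≤ RCLike.re ⟪y, (((H₀ + V) - (E : ℂ) • 1) x - V x)⟫_ℂ := by
          rw [sub_apply, inner_sub_right, map_sub, h₁, h₂] at h₀
          linarith
      _ ≤ ‖y‖ * ‖((H₀ + V) - (E : ℂ) • 1) x - V x‖ := re_inner_le_norm _ _
      _ ≤ ‖y‖ * ((δ + V₀) * ‖x‖) := by
          gcongr
          have := V.le_of_opNorm_le hV₀ x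
          linarith [norm_sub_le (((H₀ + V) - (E : ℂ) • 1) x) (V x)]
  rcases (norm_nonneg y).eq_or_lt with h | h
  · have h₄ : 0 ≤ (δ + V₀) * ‖x‖ := by
      have := V.le_of_opNorm_le hV₀ x
      linarith [norm_nonneg (((H₀ + V) - (E : ℂ) • 1) x), norm_nonneg (V x)]
    rw [← h, div_mul_eq_mul_div]
    positivity
  · rw [div_mul_eq_mul_div, le_div_iff₀ hg]
    nlinarith

/-- Abstract form of the paper's bound on the number of eigenvalues of
`Ham = H₀ + V` in a small interval inside the first Landau band:
`Tr P ≤ 2 ε⁻² Tr(P₀ V P V P₀)`. -/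
theorem trace_count_bound [TopologicalSpace.SeparableSpace H]
    (H₀ V : H →L[ℂ] H) (hH₀ : IsSelfAdjoint H₀) (hV : IsSelfAdjoint V)
    (V₀ : ℝ) (hV₀ : ‖V‖ ≤ V₀)
    (c E ε g δ : ℝ) (hε : 0 < ε) (hg : 0 < g) (hδ : 0 ≤ δ)
    (hsmall : (δ + V₀) / g ≤ 1 / 2)
    (P₀ : H →L[ℂ] H) (hP₀ : P₀ * P₀ = P₀) (hP₀sa : IsSelfAdjoint P₀)
    (hc₁ : H₀ * P₀ = (c : ℂ) • P₀) (hc₂ : P₀ * H₀ = (c : ℂ) • P₀)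
    (hQ₀ : ((1 - P₀) * (H₀ - (E : ℂ) • 1) * (1 - P₀) - (g : ℂ) • (1 - P₀)).IsPositive)
    (P : H →L[ℂ] H) (hP : P * P = P) (hPsa : IsSelfAdjoint P)
    (hfin : FiniteDimensional ℂ (LinearMap.range P.toLinearMap))
    (hcomm : (H₀ + V) * P = P * (H₀ + V))
    (hPd : ‖P * ((H₀ + V) - (E : ℂ) • 1)‖ ≤ δ)
    (hgap : ((P * ((H₀ + V) - (c : ℂ) • 1) * P) ^ 2 - ((ε : ℂ) ^ 2) • P).IsPositive) :
    (opTrace P).re ≤ 2 * ε⁻¹ ^ 2 * (opTrace (P₀ * V * P * V * P₀)).re := by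
  set A : H →L[ℂ] H := (H₀ + V) - (c : ℂ) • 1 with hA
  have hfix : ∀ x ∈ LinearMap.range P.toLinearMap, P x = x := by
    rintro _ ⟨x, rfl⟩
    exact congr($hP x)
  have hPA : P * A = A * P := by simp [hA, mul_sub, sub_mul, hcomm]
  have hAfix : ∀ x, P x = x → P (A x) = A x := fun x hx => by
    have := congr($hPA x)
    simpa [hx] using this
  have hAsa : IsSelfAdjoint A := by
    refine (hH₀.add hV).sub ?_
    simp [IsSelfAdjoint, star_smul]
  have hproj : ∀ x, P x = x → 3 / 4 * ‖x‖ ^ 2 ≤ ‖P₀ x‖ ^ 2 := fun x hx => by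
    have h₁ : ‖((H₀ + V) - (E : ℂ) • 1) x‖ ≤ δ * ‖x‖ := by
      have h₂ : P * ((H₀ + V) - (E : ℂ) • 1) = ((H₀ + V) - (E : ℂ) • 1) * P := by
        simp [mul_sub, sub_mul, hcomm]
      have h₃ := (P * ((H₀ + V) - (E : ℂ) • 1)).le_of_opNorm_le hPd x
      rwa [h₂, mul_apply_eq_comp, hx] at h₃
    have h₄ := norm_sub_apply_le_of_isPositive H₀ V V₀ hV₀ c E g δ hg P₀ hP₀ hP₀sa hc₁ hc₂ hQ₀ x h₁
    have h₅ : ‖x - P₀ x‖ ≤ 1 / 2 * ‖x‖ := h₄.trans (by gcongr)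
    have h₆ := norm_sq_eq_of_isSelfAdjoint_idem P₀ hP₀ hP₀sa x
    nlinarith [norm_nonneg (x - P₀ x), norm_nonneg x]
  have hgapx : ∀ x, P x = x → ε ^ 2 * ‖x‖ ^ 2 ≤ ‖A x‖ ^ 2 := fun x hx => by
    have h₁ := hgap.re_inner_nonneg_right x
    have h₂ : ((P * A * P) ^ 2) x = A (A x) := by
      simp [pow_two, hx, hAfix x hx, hAfix _ (hAfix x hx)]
    have h₃ : RCLike.re ⟪x, ((ε : ℂ) ^ 2 • P) x⟫_ℂ = ε ^ 2 * ‖x‖ ^ 2 := by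
      rw [smul_apply, hx, inner_smul_right, ← inner_self_eq_norm_sq (𝕜 := ℂ) x,
        ← Complex.ofReal_pow]
      exact Complex.re_ofReal_mul _ _
    have h₄ : RCLike.re ⟪x, A (A x)⟫_ℂ = ‖A x‖ ^ 2 := by
      rw [← inner_self_eq_norm_sq (𝕜 := ℂ) (A x)]
      exact congrArg _ (hAsa.isSymmetric x (A x)).symm
    rw [sub_apply, inner_sub_right, map_sub, h₂, h₃, h₄] at h₁
    linarith
  have hP₀V : ∀ x, P₀ (V x) = P₀ (A x) := fun x => by
    have := congr($hc₂ x)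
    simp at this
    simp [hA, this]
  let u := stdOrthonormalBasis ℂ (LinearMap.range P.toLinearMap)
  have htrP : (opTrace P).re = ∑ j, ‖(u j : H)‖ ^ 2 := by
    have h₁ := opTrace_adjoint_mul_self _ u P fun x => ⟨x, rfl⟩
    rw [hPsa.adjoint_eq, hP] at h₁
    rw [h₁]
    exact Finset.sum_congr rfl fun j _ => by rw [hfix _ (u j).2]
  have htrV : (opTrace (P₀ * V * P * V * P₀)).re = ∑ j, ‖P₀ (V (u j : H))‖ ^ 2 := by
    have hadj : ContinuousLinearMap.adjoint (P * V * P₀) = P₀ * V * P := by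
      rw [← ContinuousLinearMap.star_eq_adjoint]
      simp only [star_mul, hPsa.star_eq, hV.star_eq, hP₀sa.star_eq, mul_assoc]
    have h₁ := opTrace_adjoint_mul_self _ u (P * V * P₀) fun x => ⟨V (P₀ x), rfl⟩
    have h₂ : P₀ * V * P * (P * V * P₀) = P₀ * V * P * V * P₀ := by
      rw [← mul_assoc, ← mul_assoc, mul_assoc (P₀ * V) P P, hP]
    rw [hadj, h₂] at h₁
    rw [h₁]
    exact Finset.sum_congr rfl fun j _ => by simp [hfix _ (u j).2]
  rw [htrP, htrV, Finset.mul_sum]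
  refine Finset.sum_le_sum fun j _ => ?_
  have hu := hfix _ (u j).2
  have h₁ := hproj _ (hAfix _ hu)
  have h₂ := hgapx _ hu
  rw [hP₀V, inv_pow, mul_assoc, ← div_eq_inv_mul, ← mul_div_assoc, le_div_iff₀ (by positivity)]
  nlinarith [sq_nonneg ‖P₀ (A (u j : H))‖]
end

section
/- For B > 0 and L > 0 define K_B((x,y),(x',y')) = (B/(2π))·exp(−(B/4)((x−x')² + (y−y')²))·exp(i(B/2)(x+x')(y−y')) and the periodized kernel P^L_B(a,b) = Σ_{m∈ℤ} K_B((a₁, a₂ − mL), b) for a = (a₁,a₂), b ∈ ℝ². Then the series converges absolutely for every a, b; P^L_B is L-periodic in the second coordinate of each argument; and for all a, b ∈ ℝ² one has ∫_ℝ ∫_{−L/2}^{L/2} P^L_B(a,(c₁,c₂))·P^L_B((c₁,c₂),b) dc₂ dc₁ = P^L_B(a,b). -/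
open MeasureTheory

/-- The integral kernel of the projection onto the lowest Landau level of the Landau
Hamiltonian with magnetic field `B` on the plane `ℝ²`, in the Landau gauge. -/
noncomputable def landauKernel (B : ℝ) (a b : ℝ × ℝ) : ℂ :=
  ((B / (2 * Real.pi) : ℝ) : ℂ) *
    Complex.exp (((-(B / 4) * ((a.1 - b.1) ^ 2 + (a.2 - b.2) ^ 2) : ℝ) : ℂ)) *
    Complex.exp (Complex.I * ((B / 2 * (a.1 + b.1) * (a.2 - b.2) : ℝ) : ℂ))

/-- The periodization of the lowest Landau level kernel: the kernel of the projection onto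
the first Landau level on the cylinder `ℝ × [-L/2, L/2]` with periodic boundary conditions
in `y`. -/
noncomputable def periodizedKernel (B L : ℝ) (a b : ℝ × ℝ) : ℂ :=
  ∑' m : ℤ, landauKernel B (a.1, a.2 - m * L) b

theorem MeasureTheory.integrable_tsum_of_summable_integral_norm {α : Type*} [MeasurableSpace α]
    {μ : Measure α} {ι : Type*} [Countable ι] {F : ι → α → ℂ} (hm : ∀ i, Measurable (F i))
    (hF_int : ∀ i, Integrable (F i) μ) (hF_sum : Summable fun i ↦ ∫ a, ‖F i a‖ ∂μ) :
    Integrable (fun a ↦ ∑' i, F i a) μ := by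
  refine ⟨(Measurable.tsum hm).aestronglyMeasurable, ?_⟩
  calc ∫⁻ a, ‖∑' i, F i a‖ₑ ∂μ ≤ ∫⁻ a, ∑' i, ‖F i a‖ₑ ∂μ :=
        lintegral_mono fun a ↦ enorm_tsum_le_tsum_enorm
    _ = ∑' i, ∫⁻ a, ‖F i a‖ₑ ∂μ := lintegral_tsum fun i ↦ (hm i).enorm.aemeasurable
    _ = ∑' i, ENNReal.ofReal (∫ a, ‖F i a‖ ∂μ) :=
        tsum_congr fun i ↦ (ofReal_integral_norm_eq_lintegral_enorm (hF_int i)).symm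
    _ < ⊤ := hF_sum.tsum_ofReal_lt_top

theorem MeasureTheory.Integrable.hasSum_intervalIntegral_comp_add_int_mul {E : Type*}
    [NormedAddCommGroup E] [NormedSpace ℝ E] {f : ℝ → E} (hf : Integrable f)
    {L : ℝ} (hL : 0 < L) :
    HasSum (fun n : ℤ ↦ ∫ x in (-(L / 2))..(L / 2), f (x + n * L)) (∫ x, f x) := by
  have h : HasSum (fun n : ℤ ↦ ∫ x in Set.Ioc (-(L / 2) + n • L) (-(L / 2) + (n + 1) • L), f x)
      (∫ x, f x) := by
    rw [← setIntegral_univ, ← iUnion_Ioc_add_zsmul hL (-(L / 2))]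
    exact hasSum_integral_iUnion (fun _ ↦ measurableSet_Ioc)
      (Set.pairwise_disjoint_Ioc_add_zsmul _ _) hf.integrableOn
  convert h using 2 with n
  rw [intervalIntegral.integral_comp_add_right, intervalIntegral.integral_of_le (by linarith)]
  congr 3
  · rw [zsmul_eq_mul]
  · rw [zsmul_eq_mul]
    push_cast
    ring

/-- Unfolding: integrating a periodization over one period gives the integral over the line. -/
theorem intervalIntegral_tsum_comp_add_int_mul {f : ℝ → ℂ} (hf : Integrable f)
    {L : ℝ} (hL : 0 < L) :
    ∫ x in (-(L / 2))..(L / 2), ∑' n : ℤ, f (x + n * L) = ∫ x, f x := by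
  rw [← (hf.hasSum_intervalIntegral_comp_add_int_mul hL).tsum_eq]
  have hle : -(L / 2) ≤ L / 2 := by linarith
  have hs := (hf.norm.hasSum_intervalIntegral_comp_add_int_mul hL).summable
  simp only [intervalIntegral.integral_of_le hle] at hs ⊢
  exact (integral_tsum_of_summable_integral_norm
    (fun n : ℤ ↦ (hf.comp_add_right (n * L)).integrableOn) hs).symm

theorem summable_exp_neg_mul_sub_int_mul_sq {c L : ℝ} (hc : 0 < c) (hL : 0 < L) (u : ℝ) :
    Summable fun n : ℤ ↦ Real.exp (-c * (u - n * L) ^ 2) := by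
  have h := ((summable_jacobiTheta₂_term_iff
    (((-(c * u * L / Real.pi) : ℝ) : ℂ) * Complex.I)
    (((c * L ^ 2 / Real.pi : ℝ) : ℂ) * Complex.I)).2 (by
      simp only [Complex.im_ofReal_mul, Complex.I_im]; positivity)).norm.mul_left (Real.exp (-c * u ^ 2))
  refine h.congr fun n ↦ ?_
  rw [norm_jacobiTheta₂_term, ← Real.exp_add]
  congr 1
  simp only [Complex.im_ofReal_mul, Complex.I_im]
  field_simp
  ring

theorem integrable_exp_neg_mul_sub_sq {c : ℝ} (hc : 0 < c) (u : ℝ) :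
    Integrable fun v : ℝ ↦ Real.exp (-c * (v - u) ^ 2) :=
  (integrable_exp_neg_mul_sq hc).comp_sub_right u

theorem norm_landauKernel {B : ℝ} (hB : 0 < B) (a b : ℝ × ℝ) :
    ‖landauKernel B a b‖ = B / (2 * Real.pi) *
      Real.exp (-(B / 4) * ((a.1 - b.1) ^ 2 + (a.2 - b.2) ^ 2)) := by
  have : 0 < B / (2 * Real.pi) := by positivity
  rw [landauKernel, norm_mul, norm_mul, Complex.norm_real, Complex.norm_exp_ofReal,
    mul_comm Complex.I, Complex.norm_exp_ofReal_mul_I, mul_one, Real.norm_of_nonneg this.le]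

theorem summable_norm_landauKernel {B L : ℝ} (hB : 0 < B) (hL : 0 < L) (a b : ℝ × ℝ) :
    Summable fun m : ℤ ↦ ‖landauKernel B (a.1, a.2 - m * L) b‖ := by
  refine ((summable_exp_neg_mul_sub_int_mul_sq (c := B / 4) (by positivity) hL
    (a.2 - b.2)).mul_left
      (B / (2 * Real.pi) * Real.exp (-(B / 4) * (a.1 - b.1) ^ 2))).congr fun m ↦ ?_
  rw [norm_landauKernel hB, mul_assoc, ← Real.exp_add]
  congr 2
  ring

theorem landauKernel_congr_sub (B : ℝ) {x x' y y' z z' : ℝ} (h : y - y' = z - z') :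
    landauKernel B (x, y) (x', y') = landauKernel B (x, z) (x', z') := by
  simp only [landauKernel, h]

@[fun_prop]
theorem continuous_landauKernel (B : ℝ) :
    Continuous fun p : (ℝ × ℝ) × (ℝ × ℝ) ↦ landauKernel B p.1 p.2 := by
  unfold landauKernel
  fun_prop

theorem periodizedKernel_add_left (B L : ℝ) (a b : ℝ × ℝ) (k : ℤ) :
    periodizedKernel B L (a.1, a.2 + k * L) b = periodizedKernel B L a b := by
  unfold periodizedKernel
  rw [← (Equiv.addRight k).tsum_eq]
  refine tsum_congr fun m ↦ landauKernel_congr_sub B ?_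
  simp only [Equiv.coe_addRight]
  push_cast
  ring

theorem periodizedKernel_add_right (B L : ℝ) (a b : ℝ × ℝ) (k : ℤ) :
    periodizedKernel B L a (b.1, b.2 + k * L) = periodizedKernel B L a b := by
  rw [← periodizedKernel_add_left B L a b (-k)]
  unfold periodizedKernel
  refine tsum_congr fun m ↦ landauKernel_congr_sub B ?_
  push_cast
  ring

theorem tsum_landauKernel_add_int_mul (B L : ℝ) (a : ℝ × ℝ) (c v : ℝ) :
    ∑' m : ℤ, landauKernel B a (c, v + m * L) = periodizedKernel B L a (c, v) := by
  refine tsum_congr fun m ↦ landauKernel_congr_sub B ?_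
  ring

theorem norm_landauKernel_mul {B : ℝ} (hB : 0 < B) (a b : ℝ × ℝ) (c v t : ℝ) :
    ‖landauKernel B a (c, v) * landauKernel B (c, v - t) b‖ =
      ((B / (2 * Real.pi)) ^ 2 * Real.exp (-(B / 4) * ((a.1 - c) ^ 2 + (c - b.1) ^ 2)) *
        Real.exp (-(B / 8) * (a.2 - b.2 - t) ^ 2)) *
          Real.exp (-(B / 2) * (v - (a.2 + (b.2 + t)) / 2) ^ 2) := by
  rw [norm_mul, norm_landauKernel hB, norm_landauKernel hB, mul_mul_mul_comm, ← Real.exp_add,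
    mul_assoc (_ ^ 2), mul_assoc (_ ^ 2), ← Real.exp_add, ← Real.exp_add, ← sq]
  congr 2
  ring

theorem integrable_landauKernel_mul {B : ℝ} (hB : 0 < B) (a b : ℝ × ℝ) (c t : ℝ) :
    Integrable fun v ↦ landauKernel B a (c, v) * landauKernel B (c, v - t) b := by
  refine ((integrable_exp_neg_mul_sub_sq (half_pos hB) ((a.2 + (b.2 + t)) / 2)).const_mul
    ((B / (2 * Real.pi)) ^ 2 * Real.exp (-(B / 4) * ((a.1 - c) ^ 2 + (c - b.1) ^ 2)) *
        Real.exp (-(B / 8) * (a.2 - b.2 - t) ^ 2))).mono'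
    (Continuous.aestronglyMeasurable (by fun_prop)) (.of_forall fun v ↦ ?_)
  exact (norm_landauKernel_mul hB a b c v t).le

theorem summable_integral_norm_landauKernel_mul {B L : ℝ} (hB : 0 < B) (hL : 0 < L)
    (a b : ℝ × ℝ) (c : ℝ) :
    Summable fun n : ℤ ↦
      ∫ v, ‖landauKernel B a (c, v) * landauKernel B (c, v - n * L) b‖ := by
  simp only [norm_landauKernel_mul hB, integral_const_mul]
  simp only [integral_sub_right_eq_self fun v : ℝ ↦ Real.exp (-(B / 2) * v ^ 2)]
  exact ((summable_exp_neg_mul_sub_int_mul_sq (by positivity) hL _).mul_left _).mul_right _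

/-- The integral over the second coordinate of the intermediate point is a Gaussian in its first
coordinate. -/
theorem integral_snd_landauKernel_mul {B : ℝ} (hB : 0 < B) (a b : ℝ × ℝ) (c t : ℝ) :
    ∫ v, landauKernel B a (c, v) * landauKernel B (c, v - t) b =
      ((B / (2 * Real.pi) : ℝ) : ℂ) ^ 2 * (Real.pi / (B / 2)) ^ (1 / 2 : ℂ) *
        Complex.exp (-(B / 2) * c ^ 2 +
          (B / 2 * (a.1 + b.1) + Complex.I * (B / 2) * (a.2 - b.2 - t)) * c +
          (-(B / 4) * (a.1 ^ 2 + b.1 ^ 2 + a.2 ^ 2 + (b.2 + t) ^ 2) +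
            Complex.I * (B / 2) * (a.1 * a.2 - b.1 * (b.2 + t)) +
            B / 8 * (a.2 + b.2 + t + Complex.I * (b.1 - a.1)) ^ 2)) := by
  have hB' : (B : ℂ) ≠ 0 := by exact_mod_cast hB.ne'
  have key (v : ℝ) : landauKernel B a (c, v) * landauKernel B (c, v - t) b =
      ((B / (2 * Real.pi) : ℝ) : ℂ) ^ 2 * Complex.exp (-(B / 2) * v ^ 2 +
        (B / 2 * (a.2 + (b.2 + t)) + Complex.I * (B / 2) * (b.1 - a.1)) * v +
        (-(B / 4) * (a.2 ^ 2 + (b.2 + t) ^ 2 + (a.1 - c) ^ 2 + (c - b.1) ^ 2) +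
          Complex.I * (B / 2) * ((a.1 + c) * a.2 - (c + b.1) * (b.2 + t)))) := by
    simp only [landauKernel, mul_assoc, ← Complex.exp_add]
    rw [mul_left_comm (Complex.exp _), ← Complex.exp_add, ← mul_assoc, ← sq]
    congr 2
    push_cast
    ring
  have hre : (-((B : ℂ) / 2)).re < 0 := by simpa using hB
  simp only [key]
  rw [integral_const_mul, integral_cexp_quadratic hre, neg_neg, ← mul_assoc]
  congr 2
  field_simp
  ring

theorem integral_integral_landauKernel_mul {B : ℝ} (hB : 0 < B) (a b : ℝ × ℝ) (t : ℝ) :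
    ∫ c, ∫ v, landauKernel B a (c, v) * landauKernel B (c, v - t) b =
      landauKernel B (a.1, a.2 - t) b := by
  have hB' : (B : ℂ) ≠ 0 := by exact_mod_cast hB.ne'
  have hre : (-((B : ℂ) / 2)).re < 0 := by simpa using hB
  have hpi : (Real.pi : ℂ) ≠ 0 := by exact_mod_cast Real.pi_ne_zero
  simp only [integral_snd_landauKernel_mul hB]
  rw [integral_const_mul, integral_cexp_quadratic hre, neg_neg]
  have hsq : ((Real.pi : ℂ) / (B / 2)) ^ (1 / 2 : ℂ) * (Real.pi / (B / 2)) ^ (1 / 2 : ℂ) =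
      Real.pi / (B / 2) := by
    rw [← Complex.cpow_add _ _ (by simp [hB', hpi])]
    norm_num
  rw [← mul_assoc, mul_assoc (_ ^ 2), hsq, landauKernel, mul_assoc (Complex.ofReal _),
    ← Complex.exp_add]
  congr 1
  · push_cast
    field_simp
  · congr 1
    push_cast
    field_simp
    ring_nf
    simp only [Complex.I_sq]
    ring

theorem integrable_integral_snd_landauKernel_mul {B : ℝ} (hB : 0 < B) (a b : ℝ × ℝ) (t : ℝ) :
    Integrable fun c ↦ ∫ v, landauKernel B a (c, v) * landauKernel B (c, v - t) b := by
  simp only [integral_snd_landauKernel_mul hB]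
  exact (integrable_cexp_quadratic' (by simpa using hB) _ _).const_mul _

theorem norm_integral_snd_landauKernel_mul {B : ℝ} (hB : 0 < B) (a b : ℝ × ℝ) (c t : ℝ) :
    ‖∫ v, landauKernel B a (c, v) * landauKernel B (c, v - t) b‖ =
      ‖((B / (2 * Real.pi) : ℝ) : ℂ) ^ 2 * (Real.pi / (B / 2)) ^ (1 / 2 : ℂ)‖ *
        Real.exp (-(B / 4) * ((a.1 - c) ^ 2 + (c - b.1) ^ 2) - B / 8 * (a.1 - b.1) ^ 2) *
          Real.exp (-(B / 8) * (a.2 - b.2 - t) ^ 2) := by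
  rw [integral_snd_landauKernel_mul hB, norm_mul, Complex.norm_exp, mul_assoc ‖_‖, ← Real.exp_add]
  congr 2
  simp [sq]
  ring

theorem summable_integral_norm_integral_landauKernel_mul {B L : ℝ} (hB : 0 < B) (hL : 0 < L)
    (a b : ℝ × ℝ) :
    Summable fun n : ℤ ↦
      ∫ c, ‖∫ v, landauKernel B a (c, v) * landauKernel B (c, v - n * L) b‖ := by
  simp only [norm_integral_snd_landauKernel_mul hB, integral_mul_const]
  exact (summable_exp_neg_mul_sub_int_mul_sq (by positivity) hL _).mul_left _

/-- For a fixed first coordinate, the integral of the product of two periodized kernels over one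
period is a sum of integrals over the line. -/
theorem intervalIntegral_periodizedKernel_mul {B L : ℝ} (hB : 0 < B) (hL : 0 < L)
    (a b : ℝ × ℝ) (c : ℝ) :
    ∫ v in (-(L / 2))..(L / 2), periodizedKernel B L a (c, v) * periodizedKernel B L (c, v) b =
      ∑' n : ℤ, ∫ v, landauKernel B a (c, v) * landauKernel B (c, v - n * L) b := by
  have hint (n : ℤ) := integrable_landauKernel_mul hB a b c (n * L)
  have hsum := summable_integral_norm_landauKernel_mul hB hL a b c
  have hF := integrable_tsum_of_summable_integral_norm
    (fun n : ℤ ↦ Continuous.measurable (by fun_prop)) hint hsum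
  rw [integral_tsum_of_summable_integral_norm hint hsum,
    ← intervalIntegral_tsum_comp_add_int_mul hF hL]
  refine intervalIntegral.integral_congr fun v _ ↦ ?_
  simp only [tsum_mul_left]
  rw [← tsum_landauKernel_add_int_mul, ← tsum_mul_right]
  refine tsum_congr fun m ↦ ?_
  rw [← periodizedKernel_add_left B L (c, v) b m]
  rfl

/-- The periodized Landau kernel: the defining series converges
absolutely, the kernel is `L`-periodic in the second coordinate of each argument, and it
satisfies the reproducing identity on the cylinder `ℝ × [-L/2, L/2]`. -/
theorem periodizedKernel_reproducing (B L : ℝ) (hB : 0 < B) (hL : 0 < L) :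
    (∀ a b : ℝ × ℝ, Summable fun m : ℤ => ‖landauKernel B (a.1, a.2 - m * L) b‖) ∧
      (∀ a b : ℝ × ℝ,
        periodizedKernel B L (a.1, a.2 + L) b = periodizedKernel B L a b ∧
          periodizedKernel B L a (b.1, b.2 + L) = periodizedKernel B L a b) ∧
      (∀ a b : ℝ × ℝ,
        (∫ c₁ : ℝ, ∫ c₂ in (-(L / 2))..(L / 2),
            periodizedKernel B L a (c₁, c₂) * periodizedKernel B L (c₁, c₂) b)
          = periodizedKernel B L a b) := by
  refine ⟨summable_norm_landauKernel hB hL, fun a b ↦ ⟨?_, ?_⟩, fun a b ↦ ?_⟩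
  · simpa using periodizedKernel_add_left B L a b 1
  · simpa using periodizedKernel_add_right B L a b 1
  · simp only [intervalIntegral_periodizedKernel_mul hB hL]
    rw [← integral_tsum_of_summable_integral_norm
      (fun n : ℤ ↦ integrable_integral_snd_landauKernel_mul hB a b (n * L))
      (summable_integral_norm_integral_landauKernel_mul hB hL a b)]
    exact tsum_congr fun n ↦ integral_integral_landauKernel_mul hB a b (n * L)
end

section
/- For B > 0 and L > 0 with BL² ≥ 8, let P^L_B(a,b) = Σ_{m∈ℤ} K_B((a₁, a₂ − mL), b) where K_B((x,y),(x',y')) = (B/(2π))·exp(−(B/4)((x−x')² + (y−y')²))·exp(i(B/2)(x+x')(y−y')). Then for every a ∈ ℝ² the diagonal value P^L_B(a,a) is real and satisfies |P^L_B(a,a) − B/(2π)| ≤ (B/π)·e^{−BL²/4}/(1 − e^{−BL²/4}); in particular P^L_B(a,a) ≤ B/π. -/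
open MeasureTheory

/-- A two-sided series dominated by a two-sided geometric series differs from its central
term by at most the two geometric tails. -/
theorem norm_tsum_int_sub_zero_le {f : ℤ → ℂ} {c r : ℝ} (hr₀ : 0 ≤ r) (hr₁ : r < 1)
    (hf : ∀ m, ‖f m‖ ≤ c * r ^ m.natAbs) :
    ‖∑' m, f m - f 0‖ ≤ 2 * c * r / (1 - r) := by
  have hg : HasSum (fun n : ℕ => c * r * r ^ n) (c * r * (1 - r)⁻¹) :=
    (hasSum_geometric_of_lt_one hr₀ hr₁).mul_left _
  have hpos : ∀ n : ℕ, ‖f (n + 1)‖ ≤ c * r * r ^ n := fun n => by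
    have h := hf (n + 1)
    rw [show ((n : ℤ) + 1).natAbs = n + 1 by omega, pow_succ'] at h
    linarith
  have hneg : ∀ n : ℕ, ‖f (-(n + 1))‖ ≤ c * r * r ^ n := fun n => by
    have h := hf (-(n + 1))
    rw [show (-((n : ℤ) + 1)).natAbs = n + 1 by omega, pow_succ'] at h
    linarith
  rw [tsum_of_add_one_of_neg_add_one (.of_norm_bounded hg.summable hpos)
    (.of_norm_bounded hg.summable hneg)]
  calc _ = ‖∑' n : ℕ, f (n + 1) + ∑' n : ℕ, f (-(n + 1))‖ := by congr 1; ring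
    _ ≤ c * r * (1 - r)⁻¹ + c * r * (1 - r)⁻¹ :=
      norm_add_le_of_le (tsum_of_norm_bounded hg hpos) (tsum_of_norm_bounded hg hneg)
    _ = 2 * c * r / (1 - r) := by ring

theorem norm_landauKernel_translate_le {B : ℝ} (hB : 0 < B) (L : ℝ) (a : ℝ × ℝ) (m : ℤ) :
    ‖landauKernel B (a.1, a.2 - m * L) a‖ ≤
      B / (2 * Real.pi) * Real.exp (-(B * L ^ 2) / 4) ^ m.natAbs := by
  have hc : 0 < B / (2 * Real.pi) := by positivity
  have hm : (m.natAbs : ℝ) ≤ (m : ℝ) ^ 2 := by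
    have h : (m.natAbs : ℝ) ≤ (m.natAbs : ℝ) ^ 2 := by
      exact_mod_cast Nat.le_self_pow two_ne_zero _
    calc (m.natAbs : ℝ) ≤ (m.natAbs : ℝ) ^ 2 := h
      _ = (m : ℝ) ^ 2 := by rw [Nat.cast_natAbs, Int.cast_abs, sq_abs]
  rw [landauKernel, norm_mul, norm_mul, Complex.norm_exp_I_mul_ofReal, Complex.norm_exp_ofReal,
    Complex.norm_real, Real.norm_of_nonneg hc.le, mul_one, ← Real.exp_nat_mul]
  refine mul_le_mul_of_nonneg_left (Real.exp_le_exp.mpr ?_) hc.le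
  have hBL : 0 ≤ B * L ^ 2 := by positivity
  nlinarith [mul_le_mul_of_nonneg_right hm hBL]

theorem conj_landauKernel_translate (B L : ℝ) (a : ℝ × ℝ) (m : ℤ) :
    (starRingEnd ℂ) (landauKernel B (a.1, a.2 - m * L) a) =
      landauKernel B (a.1, a.2 - (-m : ℤ) * L) a := by
  simp only [landauKernel, map_mul, ← Complex.exp_conj, Complex.conj_ofReal, Complex.conj_I]
  congr 2
  · congr 3
    push_cast
    ring
  · push_cast
    ring

theorem periodizedKernel_diagonal_im (B L : ℝ) (a : ℝ × ℝ) :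
    (periodizedKernel B L a a).im = 0 := by
  rw [← Complex.conj_eq_iff_im, periodizedKernel, Complex.conj_tsum]
  simp only [conj_landauKernel_translate]
  exact (Equiv.neg ℤ).tsum_eq fun m : ℤ => landauKernel B (a.1, a.2 - m * L) a

/-- For `B L² ≥ 8` the diagonal of the periodized Landau kernel is real,
is within `(B/π)·e^{-BL²/4}/(1 - e^{-BL²/4})` of `B/(2π)`, and is at most `B/π`. -/
theorem periodizedKernel_diagonal_bound (B L : ℝ) (hB : 0 < B) (hL : 0 < L)
    (hBL : 8 ≤ B * L ^ 2) :
    ∀ a : ℝ × ℝ,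
      (periodizedKernel B L a a).im = 0 ∧
        |(periodizedKernel B L a a).re - B / (2 * Real.pi)| ≤
          B / Real.pi * Real.exp (-(B * L ^ 2) / 4) / (1 - Real.exp (-(B * L ^ 2) / 4)) ∧
        (periodizedKernel B L a a).re ≤ B / Real.pi := by
  intro a
  have hr : Real.exp (-(B * L ^ 2) / 4) ≤ 1 / 3 := by
    calc _ ≤ Real.exp (-2) := Real.exp_le_exp.mpr (by linarith)
      _ = 1 / Real.exp 2 := by rw [Real.exp_neg, one_div]
      _ ≤ 1 / 3 := one_div_le_one_div_of_le (by norm_num) (by linarith [Real.add_one_le_exp 2])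
  have hbound : |(periodizedKernel B L a a).re - B / (2 * Real.pi)| ≤
      B / Real.pi * Real.exp (-(B * L ^ 2) / 4) / (1 - Real.exp (-(B * L ^ 2) / 4)) := by
    have h₀ : landauKernel B (a.1, a.2 - (0 : ℤ) * L) a = ((B / (2 * Real.pi) : ℝ) : ℂ) := by
      simp [landauKernel]
    have h := norm_tsum_int_sub_zero_le (Real.exp_nonneg _) (by linarith)
      (norm_landauKernel_translate_le hB L a)
    rw [h₀] at h
    calc _ = |(periodizedKernel B L a a - ((B / (2 * Real.pi) : ℝ) : ℂ)).re| := by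
          rw [Complex.sub_re, Complex.ofReal_re]
      _ ≤ _ := (Complex.abs_re_le_norm _).trans h
      _ = _ := by
        congr 2
        field_simp
  refine ⟨periodizedKernel_diagonal_im B L a, hbound, ?_⟩
  have hle : B / Real.pi * Real.exp (-(B * L ^ 2) / 4) / (1 - Real.exp (-(B * L ^ 2) / 4)) ≤
      B / Real.pi / 2 := by
    rw [div_le_iff₀ (by linarith)]
    nlinarith [mul_le_mul_of_nonneg_left hr (div_pos hB Real.pi_pos).le]
  have hhalf : B / (2 * Real.pi) = B / Real.pi / 2 := by ring
  linarith [(abs_le.mp hbound).2]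
end
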